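/- For every integer r ≥ 2 and every α ∈ ℂ ∖ ℤ, writing ζ^x := e^{iπx/r}, all the factors ζ^{α+r−j} − ζ^{−(α+r−j)} (j = 0, …, r−2) and ζ^{rα} − ζ^{−rα} are nonzero, and Π_{j=0}^{r−2} 1/(ζ^{α+r−j} − ζ^{−(α+r−j)}) = −ζ^{r(1−r)/2} · (ζ^{α+1} − ζ^{−(α+1)})/(ζ^{rα} − ζ^{−rα}). -/

import Mathlib

open Complex

/-- `ζ^x := e^{iπx/r}`. -/
noncomputable def zpow' (r : ℕ) (x : ℂ) : ℂ :=
  Complex.exp (Real.pi * Complex.I * x / r)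

theorem zpow'_add (r : ℕ) (x y : ℂ) : zpow' r (x + y) = zpow' r x * zpow' r y := by
  simp only [zpow', ← Complex.exp_add]
  congr 1
  ring

theorem zpow'_sum {ι : Type*} (r : ℕ) (s : Finset ι) (f : ι → ℂ) :
    zpow' r (∑ i ∈ s, f i) = ∏ i ∈ s, zpow' r (f i) := by
  simp only [zpow', ← Complex.exp_sum, Finset.mul_sum, Finset.sum_div]

theorem zpow'_natCast_mul (r n : ℕ) (x : ℂ) : zpow' r (n * x) = zpow' r x ^ n := by
  simp only [zpow', ← Complex.exp_nat_mul]
  congr 1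
  ring

theorem zpow'_neg (r : ℕ) (x : ℂ) : zpow' r (-x) = (zpow' r x)⁻¹ := by
  simp only [zpow', ← Complex.exp_neg]
  congr 1
  ring

theorem zpow'_self {r : ℕ} (hr : r ≠ 0) : zpow' r r = -1 := by
  have : (r : ℂ) ≠ 0 := Nat.cast_ne_zero.mpr hr
  rw [zpow', mul_div_cancel_right₀ _ this, Complex.exp_pi_mul_I]

theorem isPrimitiveRoot_zpow'_two {r : ℕ} (hr : r ≠ 0) : IsPrimitiveRoot (zpow' r 2) r := by
  convert Complex.isPrimitiveRoot_exp r hr using 1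
  rw [zpow']
  congr 1
  ring

theorem exists_int_of_zpow'_sub_eq_zero {r : ℕ} (hr : r ≠ 0) {x : ℂ}
    (h : zpow' r x - zpow' r (-x) = 0) : ∃ n : ℤ, x = n * r := by
  obtain ⟨n, hn⟩ := Complex.exp_eq_exp_iff_exists_int.mp (sub_eq_zero.mp h)
  have hr' : (r : ℂ) ≠ 0 := Nat.cast_ne_zero.mpr hr
  refine ⟨n, mul_left_cancel₀ (mul_ne_zero two_ne_zero Complex.two_pi_I_ne_zero) ?_⟩
  field_simp at hn
  linear_combination 2 * Complex.I * Real.pi * hn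

theorem prod_range_zpow'_sub {r : ℕ} (hr : r ≠ 0) (β : ℂ) :
    ∏ j ∈ Finset.range r, (zpow' r (β - j) - zpow' r (-(β - j))) =
      zpow' r (r * (1 - r) / 2) * (zpow' r (r * β) - zpow' r (-(r * β))) := by
  have hfactor (j : ℕ) : zpow' r (β - j) - zpow' r (-(β - j)) =
      zpow' r (β - j) * (1 - zpow' r 2 ^ j * zpow' r (-2 * β)) := by
    rw [mul_sub, ← zpow'_natCast_mul, ← zpow'_add, ← zpow'_add, mul_one]
    ring_nf
  have hsum : ∑ j ∈ Finset.range r, (β - j) = r * (1 - r) / 2 + r * β := by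
    have h : ∀ n : ℕ, ∑ j ∈ Finset.range n, (β - j) = n * (1 - n) / 2 + n * β := by
      intro n
      induction n with
      | zero => simp
      | succ n ih =>
        rw [Finset.sum_range_succ, ih]
        push_cast
        ring
    exact h r
  have hroots := congrArg (Polynomial.eval 1) (X_pow_sub_C_eq_prod
    (isPrimitiveRoot_zpow'_two hr) (Nat.pos_of_ne_zero hr)
    (zpow'_natCast_mul r r (-2 * β)).symm)
  simp only [Polynomial.eval_sub, Polynomial.eval_pow, Polynomial.eval_X, Polynomial.eval_C,
    one_pow, Polynomial.eval_prod] at hroots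
  rw [Finset.prod_congr rfl fun j _ => hfactor j, Finset.prod_mul_distrib, ← hroots,
    ← zpow'_sum, hsum, zpow'_add, mul_assoc, mul_sub (zpow' r (r * β)), ← zpow'_add]
  ring_nf

/-- **Statement 14.** For `r ≥ 2` and `α ∈ ℂ ∖ ℤ`, all factors in the definition of the
modified dimension are nonzero, and the closed form of the modified dimension holds:
`∏_{j=0}^{r−2} 1/(ζ^{α+r−j} − ζ^{−(α+r−j)})
  = −ζ^{r(1−r)/2} (ζ^{α+1} − ζ^{−(α+1)})/(ζ^{rα} − ζ^{−rα})`. -/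
theorem modified_dimension_closed_form (r : ℕ) (hr : 2 ≤ r) (α : ℂ)
    (hα : ∀ z : ℤ, α ≠ (z : ℂ)) :
    (∀ j ∈ Finset.range (r - 1),
        zpow' r (α + r - j) - zpow' r (-(α + r - j)) ≠ 0) ∧
      zpow' r (r * α) - zpow' r (-(r * α)) ≠ 0 ∧
      (∏ j ∈ Finset.range (r - 1),
          (zpow' r (α + r - j) - zpow' r (-(α + r - j)))⁻¹) =
        -zpow' r (r * (1 - r) / 2) *
          (zpow' r (α + 1) - zpow' r (-(α + 1))) /
            (zpow' r (r * α) - zpow' r (-(r * α))) := by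
  obtain ⟨m, rfl⟩ : ∃ m, r = m + 1 := ⟨r - 1, by omega⟩
  have hr0 : m + 1 ≠ 0 := m.succ_ne_zero
  have hα_add (k : ℤ) : zpow' (m + 1) (α + k) - zpow' (m + 1) (-(α + k)) ≠ 0 := fun h => by
    obtain ⟨n, hn⟩ := exists_int_of_zpow'_sub_eq_zero hr0 h
    refine hα (n * (m + 1 : ℕ) - k) ?_
    push_cast at hn ⊢
    linear_combination hn
  have hα_mul : zpow' (m + 1) ((m + 1 : ℕ) * α) - zpow' (m + 1) (-((m + 1 : ℕ) * α)) ≠ 0 :=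
    fun h => by
      obtain ⟨n, hn⟩ := exists_int_of_zpow'_sub_eq_zero hr0 h
      exact hα n (mul_left_cancel₀ (Nat.cast_ne_zero.mpr hr0) (hn.trans (mul_comm _ _)))
  have hfactors (j : ℕ) : zpow' (m + 1) (α + (m + 1 : ℕ) - j) -
      zpow' (m + 1) (-(α + (m + 1 : ℕ) - j)) ≠ 0 := by
    simpa [add_sub_assoc] using hα_add ((m + 1 : ℕ) - j)
  refine ⟨fun j _ => hfactors j, hα_mul, ?_⟩
  have hsq : zpow' (m + 1) ((m + 1 : ℕ) * (1 - (m + 1 : ℕ)) / 2) ^ 2 * (-1) ^ m = 1 := by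
    rw [← zpow'_self hr0, ← zpow'_natCast_mul, ← zpow'_natCast_mul, ← zpow'_add]
    simp [zpow']
    ring_nf
    simp
  have hshift : zpow' (m + 1) ((m + 1 : ℕ) * (α + (m + 1 : ℕ))) =
      (-1) ^ (m + 1) * zpow' (m + 1) ((m + 1 : ℕ) * α) := by
    rw [mul_add, zpow'_add, zpow'_natCast_mul _ _ ((m + 1 : ℕ) : ℂ), zpow'_self hr0, mul_comm]
  have hshift_neg : zpow' (m + 1) (-((m + 1 : ℕ) * (α + (m + 1 : ℕ)))) =
      (-1) ^ (m + 1) * zpow' (m + 1) (-((m + 1 : ℕ) * α)) := by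
    rw [mul_add, neg_add, zpow'_add, zpow'_neg, zpow'_neg,
      zpow'_natCast_mul _ _ ((m + 1 : ℕ) : ℂ), zpow'_self hr0, ← inv_pow, inv_neg_one, mul_comm]
  have hprod := prod_range_zpow'_sub hr0 (α + (m + 1 : ℕ))
  have hlast : α + ((m + 1 : ℕ) : ℂ) - m = α + 1 := by
    push_cast
    ring
  rw [Finset.prod_range_succ, hlast, hshift, hshift_neg] at hprod
  rw [Finset.prod_inv_distrib, Nat.add_sub_cancel, eq_div_iff hα_mul, inv_mul_eq_iff_eq_mul₀
    (Finset.prod_ne_zero_iff.mpr fun j _ => hfactors j)]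
  linear_combination zpow' (m + 1) ((m + 1 : ℕ) * (1 - (m + 1 : ℕ)) / 2) * hprod -
    (zpow' (m + 1) ((m + 1 : ℕ) * α) - zpow' (m + 1) (-((m + 1 : ℕ) * α))) * hsq
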